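/- Let q be a prime power with q ≡ 1 (mod 4) and set v = 1 + q + q² + q³. Then there exists a v×v matrix W over the Gaussian integers ℤ[i] with every entry in {0, 1, −1, i, −i} such that W·W* = (q+q²)·I, where W* is the conjugate transpose, and the support matrix A of W (the (0,1)-matrix with A_{ij} = 1 iff W_{ij} ≠ 0) is the adjacency matrix of a strongly regular graph SRG(v, q+q², q−1, q+1). -/

import Mathlib

open Matrix

/-- The all-ones matrix. -/
def allOnes (ι : Type*) : Matrix ι ι ℤ := Matrix.of fun _ _ => 1

/-- `A` is the adjacency matrix of a strongly regular graph with parameters `(v, k, l, mu)`. -/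
def IsSRGAdj {ι : Type*} [Fintype ι] [DecidableEq ι]
    (A : Matrix ι ι ℤ) (k l mu : ℤ) : Prop :=
  A.IsSymm ∧ (∀ i, A i i = 0) ∧ (∀ i j, A i j = 0 ∨ A i j = 1) ∧
    A * A = k • (1 : Matrix ι ι ℤ) + l • A + mu • (allOnes ι - 1 - A)

open QuadraticAlgebra LinearAlgebra.Projectivization

section QuadraticExtension

variable {F : Type*} [Field F] {d : F}

noncomputable instance [Fintype F] : Fintype (QuadraticAlgebra F d 0) :=
  Fintype.ofEquiv _ (equivProd d 0).symm

instance [DecidableEq F] : DecidableEq (QuadraticAlgebra F d 0) :=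
  (equivProd d 0).decidableEq

theorem QuadraticAlgebra.sum_eq [Fintype F] (h : QuadraticAlgebra F d 0 → ℤ) :
    ∑ t, h t = ∑ s : F, ∑ u : F, h ⟨s, u⟩ := by
  rw [← (equivProd d 0).symm.sum_comp, Fintype.sum_prod_type]
  rfl

/-- The determinant of a pair of vectors in the plane over a commutative ring. -/
def pairDet {K : Type*} [CommRing K] (x y : K × K) : K := x.1 * y.2 - x.2 * y.1

/-- The scalar `a` with `y = a • x`, for a multiple `y` of a nonzero vector `x`. -/
def pairRatio {K : Type*} [Field K] [DecidableEq K] (x y : K × K) : K :=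
  if x.1 = 0 then y.2 / x.2 else y.1 / x.1

section Plane

variable {K : Type*} [Field K]

theorem pairDet_left (x z : K × K) (a b : K) :
    pairDet x (a • x + b • z) = b * pairDet x z := by
  simp [pairDet]; ring

theorem pairDet_right (x z : K × K) (a b : K) :
    pairDet z (a • x + b • z) = -(a * pairDet x z) := by
  simp [pairDet]; ring

theorem pairDet_smul_left (x y : K × K) (c : K) : pairDet (c • x) y = c * pairDet x y := by
  simp [pairDet]; ring

theorem pairDet_swap (x y : K × K) : pairDet y x = -pairDet x y := by
  simp [pairDet]; ring

theorem pairDet_self (x : K × K) : pairDet x x = 0 := by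
  simp [pairDet]; ring

theorem exists_pairDet_ne_zero {x : K × K} (hx : x ≠ 0) : ∃ z, pairDet x z ≠ 0 := by
  by_cases h : x.1 = 0
  · refine ⟨(1, 0), ?_⟩
    have : x.2 ≠ 0 := fun h2 => hx (Prod.ext h h2)
    simpa [pairDet] using this
  · exact ⟨(0, 1), by simpa [pairDet] using h⟩

theorem exists_eq_smul_of_pairDet_eq_zero {x z : K × K} (hx : x ≠ 0) (h : pairDet x z = 0) :
    ∃ a : K, z = a • x := by
  unfold pairDet at h
  by_cases h1 : x.1 = 0
  · have h2 : x.2 ≠ 0 := fun h2 => hx (Prod.ext h1 h2)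
    refine ⟨z.2 / x.2, Prod.ext ?_ ?_⟩
    · simp [h1] at h ⊢
      tauto
    · simp [h2]
  · refine ⟨z.1 / x.1, Prod.ext ?_ ?_⟩
    · simp [h1]
    · simp
      field_simp
      linear_combination h

theorem pairRatio_smul [DecidableEq K] {x : K × K} (hx : x ≠ 0) (a : K) :
    pairRatio x (a • x) = a := by
  unfold pairRatio
  split_ifs with h
  · have h2 : x.2 ≠ 0 := fun h2 => hx (Prod.ext h h2)
    simp [h2]
  · simp [h]

theorem pairRatio_smul_smul [DecidableEq K] {x : K × K} {c : K} (hc : c ≠ 0)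
    (y : K × K) : pairRatio (c • x) y = pairRatio x y / c := by
  unfold pairRatio
  by_cases h : x.1 = 0 <;> simp [h, hc] <;> field_simp

theorem sum_eq_sum_combination [Fintype K] {x z : K × K} (hD : pairDet x z ≠ 0)
    (h : K × K → ℤ) : ∑ y, h y = ∑ a : K, ∑ b : K, h (a • x + b • z) := by
  rw [← Fintype.sum_prod_type' (f := fun a b : K => h (a • x + b • z))]
  symm
  refine Fintype.sum_bijective (fun p : K × K => p.1 • x + p.2 • z) ?_ _ _ fun _ => rfl
  rw [← Finite.injective_iff_bijective]
  rintro ⟨a, b⟩ ⟨a', b'⟩ e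
  have e1 := congrArg (pairDet x) e
  have e2 := congrArg (pairDet z) e
  simp only [pairDet_left, pairDet_right, neg_inj] at e1 e2
  exact Prod.ext (mul_right_cancel₀ hD e2) (mul_right_cancel₀ hD e1)

theorem sum_mul_right_eq [Fintype K] {D : K} (hD : D ≠ 0) (h : K → ℤ) :
    ∑ b, h (b * D) = ∑ b, h b :=
  Equiv.sum_comp (Equiv.mulRight₀ D hD) h

end Plane

theorem card_quadraticAlgebra [Fintype F] :
    Fintype.card (QuadraticAlgebra F d 0) = Fintype.card F ^ 2 := by
  rw [Fintype.card_congr (equivProd d 0), Fintype.card_prod, sq]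

theorem eq_zero_of_im_eq_zero {m b : QuadraticAlgebra F d 0} (hm : m.im ≠ 0)
    (hb : b.im = 0) (hmb : (m * b).im = 0) : b = 0 := by
  have : b.re = 0 := by simpa [hb, hm] using hmb
  exact QuadraticAlgebra.ext this hb

/-- Indicator of the subfield `F` of a quadratic extension. -/
def subfieldInd [DecidableEq F] (t : QuadraticAlgebra F d 0) : ℤ := if t.im = 0 then 1 else 0

theorem subfieldInd_neg [DecidableEq F] (t : QuadraticAlgebra F d 0) : subfieldInd (-t) = subfieldInd t := by
  simp [subfieldInd]

theorem subfieldInd_mul_subfieldInd_mul [DecidableEq F] {m : QuadraticAlgebra F d 0} (hm : m.im ≠ 0)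
    (b : QuadraticAlgebra F d 0) :
    subfieldInd b * subfieldInd (m * b) = if b = 0 then 1 else 0 := by
  by_cases h : b = 0
  · simp [h, subfieldInd]
  · rw [if_neg h]
    by_cases hb : b.im = 0
    · by_cases hmb : (m * b).im = 0
      · exact absurd (eq_zero_of_im_eq_zero hm hb hmb) h
      · simp only [subfieldInd, hmb, if_false, mul_zero]
    · simp only [subfieldInd, hb, if_false, zero_mul]

variable [Fintype F] [DecidableEq F]

/-- The quadratic character of `F`, extended by zero to a quadratic extension. -/
noncomputable def subfieldChar (t : QuadraticAlgebra F d 0) : ℤ :=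
  if t.im = 0 then quadraticChar F t.re else 0

theorem subfieldChar_smul (c : F) (t : QuadraticAlgebra F d 0) :
    subfieldChar (c • t) = quadraticChar F c * subfieldChar t := by
  unfold subfieldChar
  by_cases hc : c = 0
  · simp [hc]
  · by_cases ht : t.im = 0 <;> simp [hc, ht, -quadraticChar_apply]

theorem subfieldChar_neg (h : quadraticChar F (-1) = 1) (t : QuadraticAlgebra F d 0) :
    subfieldChar (-t) = subfieldChar t := by
  have := subfieldChar_smul (-1) t
  rwa [h, one_mul, neg_one_smul] at this

theorem sum_subfieldChar (hF : ringChar F ≠ 2) :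
    ∑ t : QuadraticAlgebra F d 0, subfieldChar t = 0 := by
  simp [QuadraticAlgebra.sum_eq, subfieldChar, -quadraticChar_apply, quadraticChar_sum_zero hF]

theorem sum_quadraticChar_mul_self :
    ∑ s : F, quadraticChar F s * quadraticChar F s = Fintype.card F - 1 := by
  have h (s : F) : quadraticChar F s * quadraticChar F s = 1 - if s = 0 then 1 else 0 := by
    by_cases hs : s = 0
    · simp [hs]
    · simpa [hs, sq] using quadraticChar_sq_one hs
  simp [h, -quadraticChar_apply]

theorem sum_subfieldChar_mul_self :
    ∑ t : QuadraticAlgebra F d 0, subfieldChar t * subfieldChar t = Fintype.card F - 1 := by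
  simp [QuadraticAlgebra.sum_eq, subfieldChar, -quadraticChar_apply, sum_quadraticChar_mul_self]

theorem sum_quadraticChar_im_mul_self :
    ∑ t : QuadraticAlgebra F d 0, quadraticChar F t.im * quadraticChar F t.im
      = Fintype.card F * (Fintype.card F - 1) := by
  simp [QuadraticAlgebra.sum_eq, -quadraticChar_apply, sum_quadraticChar_mul_self]
  ring

theorem sum_quadraticChar_im_mul_im (hF : ringChar F ≠ 2) {m : QuadraticAlgebra F d 0}
    (hm : m.im ≠ 0) :
    ∑ t : QuadraticAlgebra F d 0, quadraticChar F t.im * quadraticChar F (t * m).im = 0 := by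
  rw [QuadraticAlgebra.sum_eq, Finset.sum_comm]
  refine Finset.sum_eq_zero fun u _ => ?_
  simp only [im_mul, zero_mul, add_zero]
  rw [← Finset.mul_sum]
  have := ((Equiv.mulRight₀ m.im hm).trans (Equiv.addRight (u * m.re))).sum_comp
    fun s => quadraticChar F s
  rw [quadraticChar_sum_zero hF] at this
  exact mul_eq_zero_of_right _ this

theorem subfieldChar_mul_subfieldChar_mul {m : QuadraticAlgebra F d 0} (hm : m.im ≠ 0)
    (b : QuadraticAlgebra F d 0) : subfieldChar b * subfieldChar (m * b) = 0 := by
  by_cases hb : b.im = 0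
  · by_cases hmb : (m * b).im = 0
    · simp [eq_zero_of_im_eq_zero hm hb hmb, subfieldChar]
    · simp only [subfieldChar, hmb, if_false, mul_zero]
  · simp only [subfieldChar, hb, if_false, zero_mul]

theorem sum_subfieldInd : ∑ t : QuadraticAlgebra F d 0, subfieldInd t = Fintype.card F := by
  simp only [QuadraticAlgebra.sum_eq, subfieldInd]
  simp

end QuadraticExtension

section Plane

variable {F : Type*} [Field F] {d : F} [Fact (∀ r : F, r ^ 2 ≠ d + 0 * r)]

theorem im_inv_ne_zero {m : QuadraticAlgebra F d 0} (hm : m.im ≠ 0) : (m⁻¹).im ≠ 0 := by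
  intro h
  have hm0 : m ≠ 0 := by rintro rfl; simp at hm
  refine inv_ne_zero hm0 (eq_zero_of_im_eq_zero hm h ?_)
  rw [mul_inv_cancel₀ hm0]
  rfl

variable {x z : QuadraticAlgebra F d 0 × QuadraticAlgebra F d 0} {m : QuadraticAlgebra F d 0}

theorem ne_zero_of_pairDet_ne_zero (hD : pairDet x z ≠ 0) : x ≠ 0 := by
  rintro rfl
  simp [pairDet] at hD

variable [Fintype F] [DecidableEq F]

/-- The part of the weighing matrix supported on pairs of vectors spanning the plane. -/
noncomputable def offLine (x y : QuadraticAlgebra F d 0 × QuadraticAlgebra F d 0) : ℤ :=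
  subfieldChar (pairDet x y)

/-- The part of the weighing matrix supported on pairs of proportional vectors. -/
noncomputable def onLine (x y : QuadraticAlgebra F d 0 × QuadraticAlgebra F d 0) : ℤ :=
  if pairDet x y = 0 then quadraticChar F (pairRatio x y).im else 0

theorem offLine_combination (a b : QuadraticAlgebra F d 0) :
    offLine x (a • x + b • z) = subfieldChar (b * pairDet x z) := by
  rw [offLine, pairDet_left]

theorem onLine_combination (hD : pairDet x z ≠ 0) (a b : QuadraticAlgebra F d 0) :
    onLine x (a • x + b • z) = if b = 0 then quadraticChar F a.im else 0 := by
  rw [onLine, pairDet_left]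
  by_cases hb : b = 0
  · simp only [hb, zero_mul, zero_smul, add_zero, if_true]
    rw [pairRatio_smul (ne_zero_of_pairDet_ne_zero hD)]
  · simp [hb, hD]

theorem offLine_smul_left (y : QuadraticAlgebra F d 0 × QuadraticAlgebra F d 0) :
    offLine (m • x) y = subfieldChar (m * pairDet x y) := by
  rw [offLine, pairDet_smul_left]

theorem onLine_smul_left_combination (hm : m ≠ 0) (hD : pairDet x z ≠ 0)
    (a b : QuadraticAlgebra F d 0) :
    onLine (m • x) (a • x + b • z) = if b = 0 then quadraticChar F (a * m⁻¹).im else 0 := by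
  rw [onLine, pairDet_smul_left, pairDet_left]
  by_cases hb : b = 0
  · simp only [hb, zero_mul, mul_zero, zero_smul, add_zero, if_true]
    rw [pairRatio_smul_smul hm, pairRatio_smul (ne_zero_of_pairDet_ne_zero hD), div_eq_mul_inv]
  · simp [hb, hD, hm]

theorem onLine_mul_offLine_smul (y : QuadraticAlgebra F d 0 × QuadraticAlgebra F d 0) :
    onLine x y * offLine (m • x) y = 0 := by
  rw [offLine_smul_left, onLine]
  split_ifs with h
  · simp [h, subfieldChar]
  · exact zero_mul _

theorem onLine_smul_mul_offLine (hm : m ≠ 0)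
    (y : QuadraticAlgebra F d 0 × QuadraticAlgebra F d 0) :
    onLine (m • x) y * offLine x y = 0 := by
  simpa [smul_smul, hm] using onLine_mul_offLine_smul (x := m • x) (m := m⁻¹) y

theorem sum_offLine_mul_offLine_smul (hx : x ≠ 0) :
    ∑ y, offLine x y * offLine (m • x) y = (Fintype.card F : ℤ) ^ 2 *
      ∑ b : QuadraticAlgebra F d 0, subfieldChar b * subfieldChar (m * b) := by
  obtain ⟨z, hD⟩ := exists_pairDet_ne_zero hx
  rw [sum_eq_sum_combination hD]
  simp only [offLine_smul_left, offLine_combination, pairDet_left]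
  rw [sum_mul_right_eq hD fun b => subfieldChar b * subfieldChar (m * b)]
  simp [card_quadraticAlgebra]

theorem sum_onLine_mul_onLine_smul (hx : x ≠ 0) (hm : m ≠ 0) :
    ∑ y, onLine x y * onLine (m • x) y =
      ∑ a : QuadraticAlgebra F d 0, quadraticChar F a.im * quadraticChar F (a * m⁻¹).im := by
  obtain ⟨z, hD⟩ := exists_pairDet_ne_zero hx
  rw [sum_eq_sum_combination hD]
  simp only [onLine_smul_left_combination hm hD, onLine_combination hD]
  refine Finset.sum_congr rfl fun a _ => ?_
  rw [Finset.sum_eq_single 0] <;> simp +contextual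

theorem sum_mul_self_add_mul_self (hx : x ≠ 0) :
    ∑ y, (offLine x y * offLine x y + onLine x y * onLine x y) =
      ((Fintype.card F : ℤ) - 1) * (Fintype.card F + Fintype.card F ^ 2) := by
  have h1 := sum_offLine_mul_offLine_smul (m := 1) hx
  have h2 := sum_onLine_mul_onLine_smul (m := 1) hx one_ne_zero
  simp only [one_smul, one_mul, inv_one, mul_one, sum_subfieldChar_mul_self,
    sum_quadraticChar_im_mul_self] at h1 h2
  rw [Finset.sum_add_distrib, h1, h2]
  ring

theorem sum_mul_add_mul_eq_zero (hF : ringChar F ≠ 2) (hx : x ≠ 0)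
    (hz : pairDet x z ≠ 0 ∨ ∃ m : QuadraticAlgebra F d 0, m.im ≠ 0 ∧ z = m • x) :
    ∑ y, (offLine x y * offLine z y + onLine x y * onLine z y) = 0 := by
  rw [Finset.sum_add_distrib]
  rcases hz with hD | ⟨m, hm, rfl⟩
  · have hD' : pairDet z x ≠ 0 := by rwa [pairDet_swap, neg_ne_zero]
    have h1 : ∑ y, offLine x y * offLine z y = 0 := by
      rw [sum_eq_sum_combination hD]
      have h (a b : QuadraticAlgebra F d 0) : offLine z (a • x + b • z) =
          subfieldChar (a * pairDet z x) := by
        rw [add_comm, offLine_combination]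
      simp only [offLine_combination, h, ← Finset.sum_mul]
      rw [sum_mul_right_eq hD subfieldChar, sum_subfieldChar hF]
      simp
    have h2 : ∑ y, onLine x y * onLine z y = 0 := by
      rw [sum_eq_sum_combination hD]
      refine Finset.sum_eq_zero fun a _ => Finset.sum_eq_zero fun b _ => ?_
      rw [onLine_combination hD, add_comm, onLine_combination hD']
      by_cases ha : a = 0 <;> by_cases hb : b = 0 <;> simp [ha, hb]
    rw [h1, h2, add_zero]
  · have hm0 : m ≠ 0 := by rintro rfl; simp at hm
    rw [sum_offLine_mul_offLine_smul hx, sum_onLine_mul_onLine_smul hx hm0,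
      sum_quadraticChar_im_mul_im hF (im_inv_ne_zero hm)]
    simp [subfieldChar_mul_subfieldChar_mul hm]

theorem sum_mul_sub_mul_eq_zero (hneg : quadraticChar F (-1) = 1)
    (hz : pairDet x z ≠ 0 ∨ ∃ m : QuadraticAlgebra F d 0, m ≠ 0 ∧ z = m • x) :
    ∑ y, (onLine x y * offLine z y - offLine x y * onLine z y) = 0 := by
  rcases hz with hD | ⟨m, hm, rfl⟩
  · have hD' : pairDet z x ≠ 0 := by rwa [pairDet_swap, neg_ne_zero]
    rw [Finset.sum_sub_distrib, sub_eq_zero]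
    have h1 : ∑ y, onLine x y * offLine z y = ∑ a : QuadraticAlgebra F d 0,
        quadraticChar F a.im * subfieldChar (a * pairDet x z) := by
      rw [sum_eq_sum_combination hD]
      refine Finset.sum_congr rfl fun a _ => ?_
      rw [Finset.sum_eq_single 0]
      · rw [onLine_combination hD, add_comm, offLine_combination, pairDet_swap x z, mul_neg,
          subfieldChar_neg hneg, if_pos rfl]
      · intro b _ hb
        rw [onLine_combination hD, if_neg hb, zero_mul]
      · simp
    have h2 : ∑ y, offLine x y * onLine z y = ∑ a : QuadraticAlgebra F d 0,
        quadraticChar F a.im * subfieldChar (a * pairDet x z) := by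
      rw [sum_eq_sum_combination hD, Finset.sum_comm]
      refine Finset.sum_congr rfl fun b _ => ?_
      rw [Finset.sum_eq_single 0]
      · rw [offLine_combination, add_comm, onLine_combination hD', if_pos rfl, mul_comm]
      · intro a _ ha
        rw [add_comm, onLine_combination hD', if_neg ha, mul_zero]
      · simp
    rw [h1, h2]
  · refine Finset.sum_eq_zero fun y _ => ?_
    rw [onLine_mul_offLine_smul, mul_comm, onLine_smul_mul_offLine hm, sub_zero]

theorem sum_subfieldInd_mul_self (hx : x ≠ 0) :
    ∑ y, subfieldInd (pairDet x y) * subfieldInd (pairDet x y) = (Fintype.card F : ℤ) ^ 3 := by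
  obtain ⟨z, hD⟩ := exists_pairDet_ne_zero hx
  have h (t : QuadraticAlgebra F d 0) : subfieldInd t * subfieldInd t = subfieldInd t := by
    simp [subfieldInd]
  simp only [h]
  rw [sum_eq_sum_combination hD]
  simp only [pairDet_left]
  rw [sum_mul_right_eq hD subfieldInd, sum_subfieldInd]
  simp [card_quadraticAlgebra]
  ring

theorem sum_subfieldInd_mul (hx : x ≠ 0)
    (hz : pairDet x z ≠ 0 ∨ ∃ m : QuadraticAlgebra F d 0, m.im ≠ 0 ∧ z = m • x) :
    ∑ y, subfieldInd (pairDet x y) * subfieldInd (pairDet z y) = (Fintype.card F : ℤ) ^ 2 := by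
  rcases hz with hD | ⟨m, hm, rfl⟩
  · rw [sum_eq_sum_combination hD]
    simp only [pairDet_left, pairDet_right, subfieldInd_neg, ← Finset.sum_mul, ← Finset.mul_sum]
    rw [sum_mul_right_eq hD subfieldInd, sum_subfieldInd, sq]
  · obtain ⟨z, hD⟩ := exists_pairDet_ne_zero hx
    rw [sum_eq_sum_combination hD]
    simp only [pairDet_smul_left, pairDet_left]
    rw [sum_mul_right_eq hD fun b => subfieldInd b * subfieldInd (m * b)]
    simp only [subfieldInd_mul_subfieldInd_mul hm]
    simp [card_quadraticAlgebra]

end Plane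

section Projective

theorem Projectivization.sum_rep {F V : Type*} [Field F] [Fintype F] [AddCommGroup V]
    [Module F V] [Fintype V] [Fintype (ℙ F V)] (h : V → ℤ)
    (hh : ∀ (c : F) (y : V), c ≠ 0 → h (c • y) = h y) :
    ((Fintype.card F : ℤ) - 1) * ∑ Q : ℙ F V, h Q.rep = ∑ y, h y - h 0 := by
  classical
  let φ : ℙ F V × Fˣ → {y : V // y ≠ 0} := fun p =>
    ⟨p.2 • p.1.rep, (smul_ne_zero_iff_ne p.2).2 p.1.rep_nonzero⟩
  have hφ : Function.Bijective φ := by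
    constructor
    · rintro ⟨P, u⟩ ⟨Q, v⟩ e
      have e' : u • P.rep = v • Q.rep := congrArg Subtype.val e
      have hPQ : P = Q := by
        rw [← P.mk_rep, ← Q.mk_rep, Projectivization.mk_eq_mk_iff]
        exact ⟨u⁻¹ * v, by rw [mul_smul, ← e', inv_smul_smul]⟩
      subst hPQ
      have : (u : F) = v := smul_left_injective F P.rep_nonzero e'
      rw [Units.ext this]
    · rintro ⟨y, hy⟩
      obtain ⟨a, ha⟩ := Projectivization.exists_smul_eq_mk_rep F y hy
      exact ⟨(Projectivization.mk F y hy, a⁻¹), Subtype.ext (by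
        change a⁻¹ • (Projectivization.mk F y hy).rep = y
        rw [← ha, inv_smul_smul])⟩
  have h1 : ∑ y : {y : V // y ≠ 0}, h y = ∑ y, h y - h 0 := by
    rw [← Finset.sum_erase_eq_sub (Finset.mem_univ (0 : V))]
    exact (Finset.sum_subtype _ (by simp) h).symm
  have h2 : ∑ p : ℙ F V × Fˣ, h p.1.rep = ∑ y : {y : V // y ≠ 0}, h y :=
    Fintype.sum_bijective φ hφ _ _ fun p => (hh p.2 p.1.rep p.2.ne_zero).symm
  rw [← h1, ← h2, Fintype.sum_prod_type, Finset.mul_sum]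
  refine Finset.sum_congr rfl fun P _ => ?_
  have : 1 ≤ Fintype.card F := Fintype.card_pos
  simp [Fintype.card_units, Nat.cast_sub this]

variable {F : Type*} [Field F] {d : F}

theorem pairDet_smul_right (c : F) (x y : QuadraticAlgebra F d 0 × QuadraticAlgebra F d 0) :
    pairDet x (c • y) = c • pairDet x y := by
  simp [pairDet, smul_sub]

theorem subfieldInd_smul [DecidableEq F] {c : F} (hc : c ≠ 0) (t : QuadraticAlgebra F d 0) :
    subfieldInd (c • t) = subfieldInd t := by
  simp [subfieldInd, hc]

theorem offLine_smul [Fintype F] [DecidableEq F] (c : F) (x y : QuadraticAlgebra F d 0 × QuadraticAlgebra F d 0) :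
    offLine x (c • y) = quadraticChar F c * offLine x y := by
  rw [offLine, pairDet_smul_right, subfieldChar_smul, offLine]

theorem card_sub_one_pos [Fintype F] : (0 : ℤ) < Fintype.card F - 1 := by
  have : 1 < Fintype.card F := Fintype.one_lt_card
  omega

theorem Projectivization.card_quadraticAlgebra_prod [Fintype F] :
    Nat.card (ℙ F (QuadraticAlgebra F d 0 × QuadraticAlgebra F d 0)) =
      1 + Fintype.card F + Fintype.card F ^ 2 + Fintype.card F ^ 3 := by
  rw [Projectivization.card_of_finrank F _ (n := 4)]
  · simp [Finset.sum_range_succ]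
  · rw [Module.finrank_prod, QuadraticAlgebra.finrank_eq_two]

variable [Fact (∀ r : F, r ^ 2 ≠ d + 0 * r)]

theorem pairRatio_smul_right [DecidableEq F] (c : F) (x y : QuadraticAlgebra F d 0 × QuadraticAlgebra F d 0) :
    pairRatio x (c • y) = c • pairRatio x y := by
  unfold pairRatio
  split_ifs <;> simp [div_eq_mul_inv]

theorem Projectivization.pairDet_rep_or
    {P Q : ℙ F (QuadraticAlgebra F d 0 × QuadraticAlgebra F d 0)} (h : P ≠ Q) :
    pairDet P.rep Q.rep ≠ 0 ∨ ∃ m : QuadraticAlgebra F d 0, m.im ≠ 0 ∧ Q.rep = m • P.rep := by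
  refine or_iff_not_imp_left.2 fun hD => ?_
  obtain ⟨m, hm⟩ := exists_eq_smul_of_pairDet_eq_zero P.rep_nonzero (not_not.1 hD)
  refine ⟨m, fun h0 => h ?_, hm⟩
  rw [← P.mk_rep, ← Q.mk_rep, eq_comm, Projectivization.mk_eq_mk_iff']
  refine ⟨m.re, ?_⟩
  have : m = algebraMap F _ m.re := QuadraticAlgebra.ext rfl h0
  rw [hm]
  conv_rhs => rw [this]
  rw [algebraMap_smul]

variable [Fintype F] [DecidableEq F]

theorem onLine_smul {c : F} (hc : c ≠ 0)
    (x y : QuadraticAlgebra F d 0 × QuadraticAlgebra F d 0) :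
    onLine x (c • y) = quadraticChar F c * onLine x y := by
  rw [onLine, pairDet_smul_right, pairRatio_smul_right, onLine]
  by_cases h : pairDet x y = 0 <;> simp [h, hc, -quadraticChar_apply]

theorem offLine_zero (x : QuadraticAlgebra F d 0 × QuadraticAlgebra F d 0) :
    offLine x 0 = 0 := by
  simp [offLine, pairDet, subfieldChar]

theorem onLine_zero (x : QuadraticAlgebra F d 0 × QuadraticAlgebra F d 0) :
    onLine x 0 = 0 := by
  simp [onLine, pairDet, pairRatio]

variable [Fintype (ℙ F (QuadraticAlgebra F d 0 × QuadraticAlgebra F d 0))]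
  [DecidableEq (ℙ F (QuadraticAlgebra F d 0 × QuadraticAlgebra F d 0))]
  (P Q : ℙ F (QuadraticAlgebra F d 0 × QuadraticAlgebra F d 0))

theorem Projectivization.sum_mul_add_mul (hF : ringChar F ≠ 2) :
    ∑ R : ℙ F (QuadraticAlgebra F d 0 × QuadraticAlgebra F d 0),
      (offLine P.rep R.rep * offLine Q.rep R.rep + onLine P.rep R.rep * onLine Q.rep R.rep) =
    if P = Q then (Fintype.card F : ℤ) + Fintype.card F ^ 2 else 0 := by
  refine mul_left_cancel₀ (card_sub_one_pos (F := F)).ne' ?_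
  rw [Projectivization.sum_rep fun y => offLine P.rep y * offLine Q.rep y +
    onLine P.rep y * onLine Q.rep y]
  · simp only [offLine_zero, onLine_zero, mul_zero, add_zero, sub_zero]
    split_ifs with h
    · rw [← h, sum_mul_self_add_mul_self P.rep_nonzero]
    · rw [sum_mul_add_mul_eq_zero hF P.rep_nonzero (pairDet_rep_or h), mul_zero]
  · intro c y hc
    have := quadraticChar_sq_one hc
    simp only [offLine_smul, onLine_smul hc]
    linear_combination (offLine P.rep y * offLine Q.rep y + onLine P.rep y * onLine Q.rep y) * this

theorem Projectivization.sum_mul_sub_mul (hneg : quadraticChar F (-1) = 1) :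
    ∑ R : ℙ F (QuadraticAlgebra F d 0 × QuadraticAlgebra F d 0),
      (onLine P.rep R.rep * offLine Q.rep R.rep - offLine P.rep R.rep * onLine Q.rep R.rep) =
    0 := by
  refine mul_left_cancel₀ (card_sub_one_pos (F := F)).ne' ?_
  rw [Projectivization.sum_rep fun y => onLine P.rep y * offLine Q.rep y -
    offLine P.rep y * onLine Q.rep y]
  · simp only [offLine_zero, onLine_zero, mul_zero, sub_zero]
    refine sum_mul_sub_mul_eq_zero hneg ?_
    by_cases h : P = Q
    · exact .inr ⟨1, one_ne_zero, by rw [h, one_smul]⟩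
    · refine (pairDet_rep_or h).imp_right fun ⟨m, hm, e⟩ => ⟨m, ?_, e⟩
      rintro rfl
      simp at hm
  · intro c y hc
    have := quadraticChar_sq_one hc
    simp only [offLine_smul, onLine_smul hc]
    linear_combination (onLine P.rep y * offLine Q.rep y - offLine P.rep y * onLine Q.rep y) * this

theorem Projectivization.sum_subfieldInd_mul :
    ∑ R : ℙ F (QuadraticAlgebra F d 0 × QuadraticAlgebra F d 0),
      subfieldInd (pairDet P.rep R.rep) * subfieldInd (pairDet Q.rep R.rep) =
    (Fintype.card F + 1 : ℤ) + if P = Q then (Fintype.card F : ℤ) ^ 2 else 0 := by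
  refine mul_left_cancel₀ (card_sub_one_pos (F := F)).ne' ?_
  rw [Projectivization.sum_rep fun y =>
    subfieldInd (pairDet P.rep y) * subfieldInd (pairDet Q.rep y)]
  · have h0 (x : QuadraticAlgebra F d 0 × QuadraticAlgebra F d 0) :
        subfieldInd (pairDet x 0) = 1 := by simp [pairDet, subfieldInd]
    simp only [h0]
    split_ifs with h
    · rw [← h, sum_subfieldInd_mul_self P.rep_nonzero]
      ring
    · rw [_root_.sum_subfieldInd_mul P.rep_nonzero (pairDet_rep_or h)]
      ring
  · intro c y hc
    simp only [pairDet_smul_right, subfieldInd_smul hc]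

end Projective


section WeighingMatrix

variable {F : Type*} [Field F] [DecidableEq F] {d : F}

/-- The reflexive collinearity matrix of the symplectic generalized quadrangle. -/
noncomputable def perpMatrix :
    Matrix (ℙ F (QuadraticAlgebra F d 0 × QuadraticAlgebra F d 0))
      (ℙ F (QuadraticAlgebra F d 0 × QuadraticAlgebra F d 0)) ℤ :=
  Matrix.of fun P Q => subfieldInd (pairDet P.rep Q.rep)

variable (P Q : ℙ F (QuadraticAlgebra F d 0 × QuadraticAlgebra F d 0))

theorem perpMatrix_eq_zero_or_one : perpMatrix P Q = 0 ∨ perpMatrix P Q = 1 := by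
  simp only [perpMatrix, of_apply, subfieldInd]
  split_ifs <;> simp

variable [Fact (∀ r : F, r ^ 2 ≠ d + 0 * r)]

theorem perpMatrix_self : perpMatrix P P = 1 := by
  simp [perpMatrix, pairDet_self, subfieldInd]

theorem perpMatrix_comm : perpMatrix Q P = perpMatrix P Q := by
  rw [perpMatrix, of_apply, of_apply, pairDet_swap, subfieldInd_neg]

variable [Fintype F]

/-- The weighing matrix on the points of projective space: real off the lines of the spread,
purely imaginary on them. -/
noncomputable def weighing :
    Matrix (ℙ F (QuadraticAlgebra F d 0 × QuadraticAlgebra F d 0))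
      (ℙ F (QuadraticAlgebra F d 0 × QuadraticAlgebra F d 0)) ℂ :=
  Matrix.of fun P Q => (offLine P.rep Q.rep : ℂ) + Complex.I * (onLine P.rep Q.rep : ℂ)

theorem weighing_mem :
    weighing P Q = 0 ∨ weighing P Q = 1 ∨ weighing P Q = -1 ∨
      weighing P Q = Complex.I ∨ weighing P Q = -Complex.I := by
  by_cases hD : pairDet P.rep Q.rep = 0
  · have h0 : offLine P.rep Q.rep = 0 := by simp [offLine, hD, subfieldChar]
    rcases quadraticChar_isQuadratic F (pairRatio P.rep Q.rep).im with h | h | h <;>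
      simp only [weighing, of_apply, h0, onLine, hD, h, if_true] <;> simp
  · have h0 : onLine P.rep Q.rep = 0 := by simp [onLine, hD]
    by_cases hi : (pairDet P.rep Q.rep).im = 0
    · rcases quadraticChar_isQuadratic F (pairDet P.rep Q.rep).re with h | h | h <;>
        simp only [weighing, of_apply, h0, offLine, subfieldChar, hi, h, if_true] <;> simp
    · simp [weighing, h0, offLine, subfieldChar, hi]

theorem weighing_self : weighing P P = 0 := by
  have : pairRatio P.rep P.rep = 1 := by
    simpa using pairRatio_smul P.rep_nonzero 1
  simp [weighing, offLine, onLine, pairDet_self, this, subfieldChar]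

theorem weighing_eq_zero_iff {P Q : ℙ F (QuadraticAlgebra F d 0 × QuadraticAlgebra F d 0)}
    (h : P ≠ Q) : weighing P Q = 0 ↔ perpMatrix P Q = 0 := by
  simp only [weighing, perpMatrix, of_apply, offLine, onLine]
  rcases Projectivization.pairDet_rep_or h with hD | ⟨m, hm, e⟩
  · by_cases hi : (pairDet P.rep Q.rep).im = 0
    · have hr : (pairDet P.rep Q.rep).re ≠ 0 := fun hr => hD (QuadraticAlgebra.ext hr hi)
      have := mt quadraticChar_eq_zero_iff.1 hr
      simp [hD, hi, subfieldChar, subfieldInd, this, -quadraticChar_apply]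
    · simp [hD, hi, subfieldChar, subfieldInd]
  · have hD : pairDet P.rep Q.rep = 0 := by
      simpa [e, pairDet_self] using pairDet_left P.rep 0 m 0
    have hr : pairRatio P.rep Q.rep = m := by rw [e, pairRatio_smul P.rep_nonzero]
    have := mt quadraticChar_eq_zero_iff.1 hm
    simp [hD, hr, subfieldChar, subfieldInd, this, quadraticChar_zero, -quadraticChar_apply]

variable [Fintype (ℙ F (QuadraticAlgebra F d 0 × QuadraticAlgebra F d 0))]
  [DecidableEq (ℙ F (QuadraticAlgebra F d 0 × QuadraticAlgebra F d 0))]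

theorem weighing_mul_conjTranspose (hF : ringChar F ≠ 2) (hneg : quadraticChar F (-1) = 1) :
    (weighing : Matrix (ℙ F (QuadraticAlgebra F d 0 × QuadraticAlgebra F d 0)) _ ℂ) * weighingᴴ =
      ((Fintype.card F : ℂ) + (Fintype.card F : ℂ) ^ 2) • 1 := by
  ext P Q
  have h1 := congrArg (Int.cast : ℤ → ℂ) (Projectivization.sum_mul_add_mul P Q hF)
  have h2 := congrArg (Int.cast : ℤ → ℂ) (Projectivization.sum_mul_sub_mul P Q hneg)
  push_cast at h1 h2
  have h3 : (weighing (F := F) (d := d) * weighingᴴ : Matrix _ _ ℂ) P Q =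
      (∑ R : ℙ F (QuadraticAlgebra F d 0 × QuadraticAlgebra F d 0), ((offLine P.rep R.rep * offLine Q.rep R.rep +
      onLine P.rep R.rep * onLine Q.rep R.rep : ℤ) : ℂ)) + Complex.I *
      ∑ R : ℙ F (QuadraticAlgebra F d 0 × QuadraticAlgebra F d 0),
      ((onLine P.rep R.rep * offLine Q.rep R.rep -
        offLine P.rep R.rep * onLine Q.rep R.rep : ℤ) : ℂ) := by
    rw [Matrix.mul_apply, Finset.mul_sum, ← Finset.sum_add_distrib]
    refine Finset.sum_congr rfl fun R _ => ?_
    simp only [weighing, conjTranspose_apply, of_apply, star_add, star_mul', Complex.star_def,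
      Complex.conj_I, map_intCast]
    push_cast
    linear_combination (-(onLine P.rep R.rep : ℂ) * onLine Q.rep R.rep) * Complex.I_mul_I
  rw [h3]
  push_cast
  rw [h1, h2]
  by_cases h : P = Q <;> simp [h]

theorem isSRGAdj_perpMatrix_sub_one :
    IsSRGAdj (perpMatrix (F := F) (d := d) - 1) ((Fintype.card F : ℤ) + (Fintype.card F : ℤ) ^ 2)
      ((Fintype.card F : ℤ) - 1) ((Fintype.card F : ℤ) + 1) := by
  refine ⟨?_, fun P => ?_, fun P Q => ?_, ?_⟩
  · refine Matrix.IsSymm.sub (Matrix.IsSymm.ext fun P Q => perpMatrix_comm P Q) Matrix.isSymm_one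
  · simp [perpMatrix_self]
  · by_cases h : P = Q
    · simp [h, perpMatrix_self]
    · simpa [h] using perpMatrix_eq_zero_or_one P Q
  · have hsq : perpMatrix (F := F) (d := d) * perpMatrix =
        ((Fintype.card F : ℤ) + 1) • allOnes _ + ((Fintype.card F : ℤ) ^ 2) • 1 := by
      ext P Q
      have := Projectivization.sum_subfieldInd_mul P Q
      simp only [Matrix.mul_apply]
      simp only [perpMatrix_comm Q]
      simp only [perpMatrix, of_apply, this]
      by_cases h : P = Q <;> simp [h, allOnes, -zsmul_eq_mul, -zsmul_one]
    rw [sub_mul, mul_sub, hsq, mul_one, one_mul]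
    module

end WeighingMatrix

theorem IsSRGAdj.submatrix {ι κ : Type*} [Fintype ι] [DecidableEq ι] [Fintype κ] [DecidableEq κ]
    {A : Matrix ι ι ℤ} {k l mu : ℤ} (h : IsSRGAdj A k l mu) (e : κ ≃ ι) :
    IsSRGAdj (A.submatrix e e) k l mu := by
  obtain ⟨h1, h2, h3, h4⟩ := h
  refine ⟨h1.submatrix e, fun i => h2 _, fun i j => h3 _ _, ?_⟩
  rw [submatrix_mul_equiv, h4]
  ext i j
  simp [allOnes, Matrix.one_apply, -zsmul_eq_mul, -zsmul_one]

theorem stmt2 (p r q : ℕ) (hp : p.Prime) (hr : 1 ≤ r) (hq : q = p ^ r)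
    (hmod : q % 4 = 1) :
    ∃ W : Matrix (Fin (1 + q + q ^ 2 + q ^ 3)) (Fin (1 + q + q ^ 2 + q ^ 3)) ℂ,
      ∃ A : Matrix (Fin (1 + q + q ^ 2 + q ^ 3)) (Fin (1 + q + q ^ 2 + q ^ 3)) ℤ,
      (∀ i j, W i j = 0 ∨ W i j = 1 ∨ W i j = -1 ∨
        W i j = Complex.I ∨ W i j = -Complex.I) ∧
      W * Wᴴ = ((q : ℂ) + (q : ℂ) ^ 2) • 1 ∧
      (∀ i j, (W i j = 0 → A i j = 0) ∧ (W i j ≠ 0 → A i j = 1)) ∧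
      IsSRGAdj A ((q : ℤ) + (q : ℤ) ^ 2) ((q : ℤ) - 1) ((q : ℤ) + 1) := by
  classical
  have : Fact p.Prime := ⟨hp⟩
  let F := GaloisField p r
  have : Fintype F := Fintype.ofFinite F
  have hcard : Fintype.card F = q := by
    rw [← Nat.card_eq_fintype_card, GaloisField.card p r (by omega), hq]
  have hF : ringChar F ≠ 2 := by
    intro h
    have := FiniteField.even_card_of_char_two h
    omega
  have hneg : quadraticChar F (-1) = 1 := by
    rw [quadraticChar_one_iff_isSquare (neg_ne_zero.2 one_ne_zero),
      FiniteField.isSquare_neg_one_iff]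
    omega
  obtain ⟨d, hd⟩ := quadraticChar_exists_neg_one hF
  have : Fact (∀ s : F, s ^ 2 ≠ d + 0 * s) := ⟨fun s hs =>
    quadraticChar_neg_one_iff_not_isSquare.1 hd ⟨s, by linear_combination -hs⟩⟩
  have : Fintype (ℙ F (QuadraticAlgebra F d 0 × QuadraticAlgebra F d 0)) := Fintype.ofFinite _
  have hP : Fintype.card (ℙ F (QuadraticAlgebra F d 0 × QuadraticAlgebra F d 0)) =
      1 + q + q ^ 2 + q ^ 3 := by
    rw [← Nat.card_eq_fintype_card, Projectivization.card_quadraticAlgebra_prod, hcard]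
  let e := (Fintype.equivFinOfCardEq hP).symm
  refine ⟨(weighing (F := F) (d := d)).submatrix e e,
    (perpMatrix (F := F) (d := d) - 1).submatrix e e, fun i j => weighing_mem _ _, ?_, ?_, ?_⟩
  · rw [conjTranspose_submatrix, submatrix_mul_equiv, weighing_mul_conjTranspose hF hneg, hcard]
    ext i j
    simp [Matrix.one_apply]
  · intro i j
    simp only [submatrix_apply, Matrix.sub_apply]
    by_cases h : e i = e j
    · simp [h, weighing_self, perpMatrix_self, Matrix.one_apply]
    · rw [weighing_eq_zero_iff h, one_apply_ne h, sub_zero, Ne, weighing_eq_zero_iff h]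
      exact ⟨id, (perpMatrix_eq_zero_or_one _ _).resolve_left⟩
  · have h := isSRGAdj_perpMatrix_sub_one (F := F) (d := d)
    rw [hcard] at h
    exact h.submatrix e
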